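/- Let φ: P(H) → P(H) be a nonexpansive map. Then the following two conditions are equivalent: (i) there exists an OSP in P(H) that φ maps onto a COSP of P(H); (ii) there is a COSP of P(H) contained in the image of φ. -/

import Mathlib

open scoped InnerProductSpace ComplexConjugate

universe u

variable {H : Type u} [NormedAddCommGroup H] [InnerProductSpace ℂ H] [CompleteSpace H]

/-- A rank-one projection: a self-adjoint idempotent bounded operator with
one-dimensional range. -/
def IsRankOneProjection (P : H →L[ℂ] H) : Prop :=
  IsSelfAdjoint P ∧ P ∘L P = P ∧ Module.finrank ℂ (LinearMap.range (P : H →ₗ[ℂ] H)) = 1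

/-- An orthogonal system of rank-one projections (OSP). -/
def IsOSP {J : Type*} (Q : J → {P : H →L[ℂ] H // IsRankOneProjection P}) : Prop :=
  ∀ α β, α ≠ β → (Q α).1 ∘L (Q β).1 = 0

/-- A complete orthogonal system of rank-one projections (COSP): an OSP such that no
rank-one projection is orthogonal to every member. -/
def IsCOSP {J : Type*} (Q : J → {P : H →L[ℂ] H // IsRankOneProjection P}) : Prop :=
  IsOSP Q ∧ ∀ R : {P : H →L[ℂ] H // IsRankOneProjection P}, ∃ α, R.1 ∘L (Q α).1 ≠ 0

/-- A rank-one projection has the form `x ↦ ⟪p, x⟫ • p` for a unit vector `p`. -/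
theorem IsRankOneProjection.exists_unit_vector {P : H →L[ℂ] H} (hP : IsRankOneProjection P) :
    ∃ p : H, ‖p‖ = 1 ∧ ∀ x, P x = ⟪p, x⟫_ℂ • p := by
  obtain ⟨hsa, hidem, hrank⟩ := hP
  obtain ⟨⟨v, w, hw⟩, hv0, hspan⟩ := finrank_eq_one_iff'.mp hrank
  have hv : v ≠ 0 := fun h => hv0 (Subtype.ext h)
  have hPv : P v = v := by
    rw [← hw]
    exact congrArg (fun A : H →L[ℂ] H => A w) hidem
  have hnorm : ‖v‖ ≠ 0 := norm_ne_zero_iff.mpr hv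
  have hnorm' : (‖v‖ : ℂ) ≠ 0 := by exact_mod_cast hnorm
  have hp : ‖((‖v‖⁻¹ : ℝ) : ℂ) • v‖ = 1 := by
    rw [norm_smul, Complex.norm_real, norm_inv, norm_norm, inv_mul_cancel₀ hnorm]
  refine ⟨((‖v‖⁻¹ : ℝ) : ℂ) • v, hp, fun x => ?_⟩
  set p := ((‖v‖⁻¹ : ℝ) : ℂ) • v with hpdef
  have hPp : P p = p := by rw [hpdef, map_smul, hPv]
  obtain ⟨c, hc⟩ : ∃ c : ℂ, P x = c • p := by
    obtain ⟨c, hc⟩ := hspan ⟨P x, x, rfl⟩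
    refine ⟨c * ‖v‖, ?_⟩
    have hcv : c • v = P x := congrArg Subtype.val hc
    rw [← hcv, hpdef, smul_smul, Complex.ofReal_inv, mul_assoc, mul_inv_cancel₀ hnorm', mul_one]
  have hinner : ⟪p, P x⟫_ℂ = ⟪p, x⟫_ℂ := by
    rw [← ContinuousLinearMap.adjoint_inner_left, hsa.adjoint_eq, hPp]
  rw [hc, inner_smul_right, inner_self_eq_norm_sq_to_K, hp] at hinner
  rw [hc, ← hinner]
  simp

/-- Orthogonal rank-one projections are at distance at least one. -/
theorem IsRankOneProjection.one_le_norm_sub {P Q : H →L[ℂ] H} (hQ : IsRankOneProjection Q)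
    (h : P ∘L Q = 0) : 1 ≤ ‖P - Q‖ := by
  obtain ⟨q, hq, hQq⟩ := hQ.exists_unit_vector
  have hfix : Q q = q := by simp [hQq, inner_self_eq_norm_sq_to_K, hq]
  have hPq : P q = 0 := by
    rw [← hfix]
    exact congrArg (fun A : H →L[ℂ] H => A q) h
  have hle := (P - Q).le_opNorm q
  simpa [hPq, hfix, hq] using hle

/-- Rank-one projections at distance at least one are orthogonal. -/
theorem IsRankOneProjection.comp_eq_zero {P Q : H →L[ℂ] H} (hP : IsRankOneProjection P)
    (hQ : IsRankOneProjection Q) (h : 1 ≤ ‖P - Q‖) : P ∘L Q = 0 := by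
  obtain ⟨p, hp, hPp⟩ := hP.exists_unit_vector
  obtain ⟨q, hq, hQq⟩ := hQ.exists_unit_vector
  have hPP : P * P = P := hP.2.1
  have hQQ : Q * Q = Q := hQ.2.1
  set t : ℝ := ‖⟪p, q⟫_ℂ‖ ^ 2 with ht
  have hmul : ⟪p, q⟫_ℂ * ⟪q, p⟫_ℂ = (t : ℂ) := by
    rw [← inner_conj_symm q p, Complex.mul_conj, Complex.normSq_eq_norm_sq]
  have hPQP : P * Q * P = (t : ℂ) • P := by
    ext x
    simp only [mul_apply_eq_comp, smul_apply, hPp, hQq,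
      inner_smul_right, smul_smul, ← hmul]
    congr 1
    ring
  have hQPQ : Q * P * Q = (t : ℂ) • Q := by
    ext x
    simp only [mul_apply_eq_comp, smul_apply, hPp, hQq,
      inner_smul_right, smul_smul, ← hmul]
    congr 1
    ring
  have hcube : (P - Q) * (P - Q) * (P - Q) = ((1 - t : ℝ) : ℂ) • (P - Q) := by
    have hexp : (P - Q) * (P - Q) * (P - Q) = (P * P) * P - (P * P) * Q - P * Q * P
        + P * (Q * Q) - Q * (P * P) + Q * P * Q + (Q * Q) * P - (Q * Q) * Q := by noncomm_ring
    rw [hexp, hPQP, hQPQ, hPP, hQQ, hPP, hQQ]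
    push_cast
    module
  have hsa : IsSelfAdjoint (P - Q) := hP.1.sub hQ.1
  have hsq : ‖(P - Q) * (P - Q)‖ = ‖P - Q‖ * ‖P - Q‖ := by
    simpa [hsa.star_eq] using CStarRing.norm_star_mul_self (x := P - Q)
  have hsa2 : IsSelfAdjoint ((P - Q) * (P - Q)) := by
    simpa [hsa.star_eq] using IsSelfAdjoint.star_mul_self (P - Q)
  have hfour : ‖((P - Q) * (P - Q)) * ((P - Q) * (P - Q))‖ =
      ‖(P - Q) * (P - Q)‖ * ‖(P - Q) * (P - Q)‖ := by
    simpa [hsa2.star_eq] using CStarRing.norm_star_mul_self (x := (P - Q) * (P - Q))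
  rw [← mul_assoc, hcube, smul_mul_assoc, norm_smul, hsq, Complex.norm_real,
    Real.norm_eq_abs] at hfour
  have habs : 1 ≤ |1 - t| := by nlinarith [mul_le_mul h h zero_le_one (norm_nonneg _)]
  have ht1 : t ≤ 1 := by
    have hle : ‖⟪p, q⟫_ℂ‖ ≤ 1 := by simpa [hp, hq] using norm_inner_le_norm (𝕜 := ℂ) p q
    exact pow_le_one₀ (norm_nonneg _) hle
  rw [abs_of_nonneg (by linarith)] at habs
  have hinner : ⟪p, q⟫_ℂ = 0 := by
    have : ‖⟪p, q⟫_ℂ‖ ^ 2 = 0 := le_antisymm (by linarith) (sq_nonneg _)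
    exact norm_eq_zero.mp (pow_eq_zero_iff two_ne_zero |>.mp this)
  ext x
  simp [hPp, hQq, hinner]

/-- Corollary 2.4. For a nonexpansive map `φ` on the set of rank-one
projections the following are equivalent: (i) `φ` maps some OSP onto a COSP;
(ii) some COSP is contained in the image of `φ`. -/
theorem maps_OSP_onto_COSP_iff_COSP_in_image
    (φ : {P : H →L[ℂ] H // IsRankOneProjection P} → {P : H →L[ℂ] H // IsRankOneProjection P})
    (hne : ∀ P Q : {P : H →L[ℂ] H // IsRankOneProjection P},
      ‖(φ P).1 - (φ Q).1‖ ≤ ‖P.1 - Q.1‖) :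
    (∃ (J : Type u) (Q : J → {P : H →L[ℂ] H // IsRankOneProjection P}),
        IsOSP Q ∧ IsCOSP (fun α => φ (Q α))) ↔
      (∃ (J : Type u) (R : J → {P : H →L[ℂ] H // IsRankOneProjection P}),
        IsCOSP R ∧ ∀ α, ∃ P, φ P = R α) := by
  constructor
  · rintro ⟨J, Q, -, hcosp⟩
    exact ⟨J, fun α => φ (Q α), hcosp, fun α => ⟨Q α, rfl⟩⟩
  · rintro ⟨J, R, hR, himage⟩
    choose Q hQ using himage
    refine ⟨J, Q, fun α β hαβ => ?_, by simpa only [hQ] using hR⟩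
    refine (Q α).2.comp_eq_zero (Q β).2 (le_trans ?_ (hne _ _))
    rw [hQ, hQ]
    exact (R β).2.one_le_norm_sub (hR.1 α β hαβ)
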